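/- Let (Ω,Σ,μ) be a finite measure space and L⁰ = L⁰(Ω,Σ,μ) the algebra of equivalence classes of measurable complex functions on Ω. The following conditions are equivalent: (i) the measure μ is not purely atomic, i.e. there exists a measurable set A with μ(A) > 0 containing no atom of μ; (ii) L⁰ admits a non-zero derivation; (iii) L⁰ admits a non-zero local derivation; (iv) L⁰ admits a local derivation which is not a derivation. -/

import Mathlib

open MeasureTheory

/-- The commutative ring structure on `L⁰ = Ω →ₘ[μ] ℂ`, the algebra of
equivalence classes (modulo `μ`-a.e. equality) of measurable complex
functions, with pointwise operations. -/
noncomputable instance AEEqFunCommRing {Ω : Type*} [MeasurableSpace Ω] {μ : Measure Ω} :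
    CommRing (Ω →ₘ[μ] ℂ) :=
  { (inferInstance : AddCommGroup (Ω →ₘ[μ] ℂ)),
    (inferInstance : CommMonoid (Ω →ₘ[μ] ℂ)) with
    left_distrib := fun f g h => AEEqFun.toGerm_injective <| by
      simp [AEEqFun.mul_toGerm, AEEqFun.add_toGerm, mul_add]
    right_distrib := fun f g h => AEEqFun.toGerm_injective <| by
      simp [AEEqFun.mul_toGerm, AEEqFun.add_toGerm, add_mul]
    zero_mul := fun f => AEEqFun.toGerm_injective <| by
      simp [AEEqFun.mul_toGerm, AEEqFun.zero_toGerm]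
    mul_zero := fun f => AEEqFun.toGerm_injective <| by
      simp [AEEqFun.mul_toGerm, AEEqFun.zero_toGerm] }

/-- The indicator function `χ_E` of a measurable set `E`, as an element of `L⁰`. -/
noncomputable def indAE {Ω : Type*} [MeasurableSpace Ω] (μ : Measure Ω)
    (E : Set Ω) (hE : MeasurableSet E) : Ω →ₘ[μ] ℂ :=
  AEEqFun.mk (E.indicator fun _ => (1 : ℂ)) (aestronglyMeasurable_const.indicator hE)

/-- `f ∈ L⁰` is countably valued: there is a countable `C ⊆ ℂ` with `f ω ∈ C` a.e.
These elements form the subalgebra `K_c`. -/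
def CountablyValued {Ω : Type*} [MeasurableSpace Ω] {μ : Measure Ω}
    (f : Ω →ₘ[μ] ℂ) : Prop :=
  ∃ C : Set ℂ, C.Countable ∧ ∀ᵐ ω ∂μ, f ω ∈ C

/-- A derivation on `L⁰`: a ℂ-linear map satisfying the Leibniz rule. -/
def IsDeriv {Ω : Type*} [MeasurableSpace Ω] {μ : Measure Ω}
    (D : (Ω →ₘ[μ] ℂ) →ₗ[ℂ] (Ω →ₘ[μ] ℂ)) : Prop :=
  ∀ f g : Ω →ₘ[μ] ℂ, D (f * g) = D f * g + f * D g

/-- A local derivation on `L⁰`: a ℂ-linear map which agrees at every point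
with some derivation. -/
def IsLocalDeriv {Ω : Type*} [MeasurableSpace Ω] {μ : Measure Ω}
    (Δ : (Ω →ₘ[μ] ℂ) →ₗ[ℂ] (Ω →ₘ[μ] ℂ)) : Prop :=
  ∀ f : Ω →ₘ[μ] ℂ, ∃ D : (Ω →ₘ[μ] ℂ) →ₗ[ℂ] (Ω →ₘ[μ] ℂ), IsDeriv D ∧ Δ f = D f

/-- `g ∈ L⁰` is integral with respect to the subalgebra `K_c` of countably valued
elements: it satisfies a monic polynomial equation with coefficients in `K_c`. -/
def IntegralOverKc {Ω : Type*} [MeasurableSpace Ω] {μ : Measure Ω}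
    (g : Ω →ₘ[μ] ℂ) : Prop :=
  ∃ n : ℕ, 1 ≤ n ∧ ∃ c : Fin n → (Ω →ₘ[μ] ℂ),
    (∀ i, CountablyValued (c i)) ∧ g ^ n + ∑ i : Fin n, c i * g ^ (i : ℕ) = 0

/-- A measurable set `A` is an atom of the measure `μ`: it has positive measure
and each of its measurable subsets has measure `0` or `μ A`. -/
def IsMeasAtom {Ω : Type*} [MeasurableSpace Ω] (μ : Measure Ω) (A : Set Ω) : Prop :=
  MeasurableSet A ∧ 0 < μ A ∧ ∀ B ⊆ A, MeasurableSet B → μ B = 0 ∨ μ B = μ A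

/-- A transcendental element of a field extension in characteristic zero is not killed by some
derivation. -/
theorem Transcendental.exists_derivation_ne_zero {k L : Type*} [Field k] [CharZero k] [Field L]
    [Algebra k L] {x : L} (hx : Transcendental k x) : ∃ D : Derivation k L L, D x ≠ 0 := by
  obtain ⟨s, hxs, hs⟩ := exists_isTranscendenceBasis_superset
    (R := k) (s := {x}) ((algebraicIndependent_unique_type_iff (ι := ({x} : Set L))).mpr hx)
  let φ : MvPolynomial s k →ₐ[k] L := MvPolynomial.aeval (Subtype.val : s → L)
  let : Algebra (MvPolynomial s k) L := φ.toAlgebra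
  have hφ (p : MvPolynomial s k) : algebraMap (MvPolynomial s k) L p = φ p := rfl
  have : IsScalarTower k (MvPolynomial s k) L := .of_algebraMap_eq fun r => by simp [hφ]
  have : FaithfulSMul (MvPolynomial s k) L := (faithfulSMul_iff_algebraMap_injective _ _).2 hs.1
  let := FractionRing.liftAlgebra (MvPolynomial s k) L
  have := FractionRing.isScalarTower_liftAlgebra (MvPolynomial s k) L
  have : Algebra.IsAlgebraic (FractionRing (MvPolynomial s k)) L := by
    rw [hs.isAlgebraic_iff (S := FractionRing (MvPolynomial s k))]
    intro i
    have h : algebraMap (MvPolynomial s k) L (MvPolynomial.X i) = i := by simp [hφ, φ]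
    rw [← h, IsScalarTower.algebraMap_apply _ (FractionRing (MvPolynomial s k)) L]
    exact isAlgebraic_algebraMap _
  have : CharZero (FractionRing (MvPolynomial s k)) := algebraRat.charZero _
  have : Algebra.FormallyEtale (FractionRing (MvPolynomial s k)) L :=
    Algebra.FormallyEtale.of_isSeparable _ L
  have : Algebra.FormallyEtale (MvPolynomial s k) (FractionRing (MvPolynomial s k)) :=
    .of_isLocalization (nonZeroDivisors _)
  have : Algebra.FormallyEtale (MvPolynomial s k) L :=
    .comp _ (FractionRing (MvPolynomial s k)) _
  classical
  let d : Derivation k (MvPolynomial s k) L :=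
    MvPolynomial.mkDerivation k (Pi.single ⟨x, hxs rfl⟩ 1)
  let e := KaehlerDifferential.tensorKaehlerEquivOfFormallyEtale k (MvPolynomial s k) L
  refine ⟨((d.liftKaehlerDifferential.liftBaseChange L).comp
    e.symm.toLinearMap).compDer (KaehlerDifferential.D k L), ?_⟩
  have h : algebraMap (MvPolynomial s k) L (MvPolynomial.X ⟨x, hxs rfl⟩) = x := by simp [hφ, φ]
  have h2 := KaehlerDifferential.tensorKaehlerEquivOfFormallyEtale_symm_D_algebraMap k
    (MvPolynomial s k) L (MvPolynomial.X ⟨x, hxs rfl⟩)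
  rw [h] at h2
  simp [e, h2, d]

open KaehlerDifferential in
/-- If every `g - c` divides a nonzero idempotent `e`, then `e • dg ≠ 0`. -/
theorem KaehlerDifferential.smul_D_ne_zero {k R : Type*} [Field k] [IsAlgClosed k] [CharZero k]
    [CommRing R] [Algebra k R] {e g : R} (he : IsIdempotentElem e) (he0 : e ≠ 0)
    (h : ∀ c : k, g - algebraMap k R c ∣ e) : e • D k R g ≠ 0 := by
  have hu : ¬ IsUnit (1 - e) := fun hu => he0 <| by
    have : (1 - e) * e = 0 := by linear_combination -he.eq
    exact (hu.mul_right_eq_zero).1 this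
  obtain ⟨m, hm, hem⟩ := exists_max_ideal_of_mem_nonunits hu
  let _ : Field (R ⧸ m) := Ideal.Quotient.field m
  have hem' : e ∉ m := fun h' => hm.ne_top <| m.eq_top_iff_one.2 <| by
    simpa using m.add_mem hem h'
  have htr : Transcendental k (Ideal.Quotient.mk m g) := fun halg => by
    obtain ⟨c, hc⟩ := minpoly.mem_range_of_degree_eq_one k _ <|
      IsAlgClosed.degree_eq_one_of_irreducible k (minpoly.irreducible halg.isIntegral)
    refine hem' (m.mem_of_dvd (h c) ?_)
    rw [← Ideal.Quotient.eq, ← hc]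
    rfl
  obtain ⟨d, hd⟩ := htr.exists_derivation_ne_zero
  let D' : Derivation k R (R ⧸ m) := d.compAlgebraMap R
  intro h0
  have h1 : e • D' g = 0 := by
    rw [← D'.liftKaehlerDifferential_comp_D, ← map_smul, h0, map_zero]
  rw [Algebra.smul_def, mul_eq_zero] at h1
  exact h1.elim (fun h => hem' (Ideal.Quotient.eq_zero_iff_mem.1 h)) hd

theorem Derivation.map_idempotent {k R : Type*} [CommRing k] [CommRing R] [Algebra k R]
    (D : Derivation k R R) {e : R} (he : IsIdempotentElem e) : D e = 0 := by
  have h : D (e * e) = D e := by rw [he.eq]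
  rw [D.leibniz, smul_eq_mul] at h
  linear_combination (2 * e - 1) * h - 4 * D e * he.eq

/-- If `R` is self-injective, a derivation with prescribed value at `g` exists as soon as the
annihilator of `dg` annihilates that value. -/
theorem Module.Baer.exists_derivation {k R : Type*} [CommRing k] [CommRing R] [Algebra k R]
    (hR : Module.Baer R R) (g e : R)
    (h : ∀ r : R, r • KaehlerDifferential.D k R g = 0 → r * e = 0) :
    ∃ D : Derivation k R R, D g = e := by
  let φ := LinearMap.toSpanSingleton R _ (KaehlerDifferential.D k R g)
  obtain ⟨ψ, hψ⟩ := hR.extension_property (φ.ker.liftQ φ le_rfl)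
    (LinearMap.ker_eq_bot.1 (Submodule.ker_liftQ_eq_bot _ _ _ le_rfl))
    (φ.ker.liftQ (LinearMap.toSpanSingleton R R e) fun r hr => h r hr)
  refine ⟨ψ.compDer (KaehlerDifferential.D k R), ?_⟩
  have : ψ (φ 1) = LinearMap.toSpanSingleton R R e 1 :=
    LinearMap.congr_fun hψ (Submodule.Quotient.mk 1)
  simpa [φ] using this

/-- On a von Neumann regular ring, the square of a derivation agrees at every point with a
multiple of it. -/
theorem Derivation.exists_smul_apply_eq {k R : Type*} [CommRing k] [CommRing R] [Algebra k R]
    (hR : ∀ f : R, ∃ f', f * f' * f = f) (D : Derivation k R R) (f : R) :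
    ∃ a : R, D (D f) = (a • D) f := by
  obtain ⟨b, hb⟩ := hR (D f)
  have he : IsIdempotentElem (D f * b) := by
    change D f * b * (D f * b) = D f * b
    linear_combination b * hb
  have h : D (D f * b * D f) = D (D f) := by rw [hb]
  rw [D.leibniz, D.map_idempotent he] at h
  refine ⟨b * D (D f), ?_⟩
  simp only [smul_eq_mul, mul_zero, add_zero, Derivation.smul_apply] at h ⊢
  linear_combination -h

theorem Derivation.eq_zero_of_leibniz_comp_self {k R : Type*} [Field k] [CharZero k]
    [CommRing R] [Algebra k R]
    (hR : ∀ f : R, ∃ f', f * f' * f = f) (D : Derivation k R R)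
    (h : ∀ f g, D (D (f * g)) = D (D f) * g + f * D (D g)) : D = 0 := by
  ext f
  obtain ⟨b, hb⟩ := hR (D f)
  have h1 := h f f
  simp only [D.leibniz, map_add, smul_eq_mul] at h1
  have h2 : (2 : R) * (D f * D f) = 0 := by linear_combination h1
  have h3 : D f * D f = 0 := by
    have : (algebraMap k R (1/2)) * 2 = 1 := by
      rw [← map_ofNat (algebraMap k R), ← map_mul]; norm_num
    linear_combination (algebraMap k R (1/2)) * h2 - D f * D f * this
  simp only [Derivation.coe_zero, Pi.zero_apply]
  linear_combination -hb + b * h3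

open scoped ENNReal in
/-- A set of finite measure containing no atom carries a measurable function whose fibres are all
null. -/
theorem exists_measurable_fiber_null {Ω : Type*} [MeasurableSpace Ω] (μ : Measure Ω)
    [IsFiniteMeasure μ] {A : Set Ω} (hA : MeasurableSet A) (hat : ∀ B ⊆ A, ¬ IsMeasAtom μ B) :
    ∃ g : Ω → ℂ, Measurable g ∧ ∀ c, μ (A ∩ g ⁻¹' {c}) = 0 := by
  let s : Set Ω → ℝ≥0∞ := fun B =>
    ⨆ (C : Set Ω) (_ : C ⊆ B ∧ MeasurableSet C), min (μ C) (μ (B \ C))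
  have le_s {B C : Set Ω} (h : C ⊆ B) (hC : MeasurableSet C) : min (μ C) (μ (B \ C)) ≤ s B :=
    le_iSup₂_of_le C ⟨h, hC⟩ le_rfl
  have s_mono {B B' : Set Ω} (h : B ⊆ B') : s B ≤ s B' := iSup₂_le fun C hC =>
    (min_le_min le_rfl (measure_mono (Set.sdiff_subset_sdiff_left h))).trans
      (le_s (hC.1.trans h) hC.2)
  have s_top (B : Set Ω) : s B ≠ ∞ := ne_top_of_le_ne_top (measure_ne_top μ Set.univ) <|
    iSup₂_le fun C _ => (min_le_left _ _).trans (measure_mono (Set.subset_univ C))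
  have hsplit (B : Set Ω) : ∃ C ⊆ B, MeasurableSet C ∧ s B / 2 ≤ min (μ C) (μ (B \ C)) := by
    rcases eq_or_ne (s B) 0 with h | h
    · exact ⟨∅, Set.empty_subset _, .empty, by simp [h]⟩
    · obtain ⟨C, hC⟩ := lt_iSup_iff.1 (ENNReal.half_lt_self h (s_top B))
      obtain ⟨hC', hC⟩ := lt_iSup_iff.1 hC
      exact ⟨C, hC'.1, hC'.2, hC.le⟩
  choose split split_sub split_meas split_le using hsplit
  let cell : List Bool → Set Ω := fun l =>
    l.rec A fun b _ B => if b then split B else B \ split B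
  have cell_meas (l : List Bool) : MeasurableSet (cell l) := by
    induction l with
    | nil => exact hA
    | cons b l ih =>
      cases b
      · exact ih.diff (split_meas _)
      · exact split_meas _
  classical
  let code : Ω → List Bool → Bool := fun ω l => decide (ω ∈ split (cell l))
  have code_meas : Measurable code := measurable_pi_lambda _ fun l =>
    measurable_to_bool <| by
      convert split_meas (cell l) using 1
      ext ω
      simp [code]
  have emb := measurableEmbedding_embeddingReal (List Bool → Bool)
  have code_null (c : List Bool → Bool) : μ (A ∩ code ⁻¹' {c}) = 0 := by
    let path : ℕ → List Bool := fun n => n.rec [] fun _ l => c l :: l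
    let T : Set Ω := ⋂ n, cell (path n)
    have hsub : A ∩ code ⁻¹' {c} ⊆ T := by
      rintro ω ⟨hω, hc⟩
      refine Set.mem_iInter.2 fun n => ?_
      induction n with
      | zero => exact hω
      | succ n ih =>
        have h : decide (ω ∈ split (cell (path n))) = c (path n) := congrFun hc (path n)
        change ω ∈ if c (path n) = true then split (cell (path n))
          else cell (path n) \ split (cell (path n))
        split_ifs with hb
        · simpa [hb] using h
        · exact ⟨ih, by simpa [hb] using h⟩
    have hT : MeasurableSet T := .iInter fun n => cell_meas _
    have hstep (n : ℕ) : μ (cell (path (n + 1))) + s T / 2 ≤ μ (cell (path n)) := by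
      have h1 : s T / 2 ≤ s (cell (path n)) / 2 :=
        ENNReal.div_le_div_right (s_mono (Set.iInter_subset _ n)) 2
      have h2 := h1.trans (split_le (cell (path n)))
      have h3 := measure_inter_add_sdiff (μ := μ) (cell (path n)) (split_meas (cell (path n)))
      rw [Set.inter_eq_self_of_subset_right (split_sub _)] at h3
      rw [← h3]
      change μ (if c (path n) = true then split (cell (path n))
          else cell (path n) \ split (cell (path n))) + _ ≤ _
      split_ifs with hb
      · gcongr
        exact h2.trans (min_le_right _ _)
      · rw [add_comm]
        gcongr
        exact h2.trans (min_le_left _ _)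
    have hbound (n : ℕ) : μ (cell (path n)) + n * (s T / 2) ≤ μ A := by
      induction n with
      | zero => simp [path, cell]
      | succ n ih =>
        refine le_trans ?_ ih
        rw [Nat.cast_succ, add_mul, one_mul, add_comm (_ * _), ← add_assoc]
        gcongr
        exact hstep n
    have hsT : s T = 0 := by
      by_contra h0
      have h2 : s T / 2 ≠ 0 := (ENNReal.half_pos h0).ne'
      obtain ⟨n, hn⟩ := ENNReal.exists_nat_mul_gt h2 (measure_ne_top μ A)
      exact absurd (hn.trans_le (le_add_self.trans (hbound n))) (lt_irrefl _)
    refine measure_mono_null hsub ?_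
    by_contra hT0
    refine hat T (Set.iInter_subset _ 0) ⟨hT, pos_iff_ne_zero.2 hT0, fun C hC hCm => ?_⟩
    have h := le_s hC hCm
    rw [hsT, nonpos_iff_eq_zero] at h
    rcases min_eq_bot.1 h with h | h
    · exact .inl h
    · right
      have := measure_inter_add_sdiff (μ := μ) T hCm
      rwa [Set.inter_eq_self_of_subset_right hC, show μ (T \ C) = 0 from h, add_zero] at this
  refine ⟨fun ω => (embeddingReal _ (code ω) : ℂ),
    Complex.measurable_ofReal.comp (emb.measurable.comp code_meas), fun z => ?_⟩
  rcases (A ∩ (fun ω => (embeddingReal _ (code ω) : ℂ)) ⁻¹' {z}).eq_empty_or_nonempty with h | h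
  · simp [h]
  · obtain ⟨ω₀, -, hω₀⟩ := h
    refine measure_mono_null ?_ (code_null (code ω₀))
    rintro ω ⟨hω, hz⟩
    exact ⟨hω, emb.injective (Complex.ofReal_injective (hz.trans hω₀.symm))⟩

/-- A family of measurable sets closed under finite unions has a countable subfamily covering
each member up to a null set. -/
theorem exists_seq_measure_diff_iUnion_eq_zero {Ω : Type*} [MeasurableSpace Ω] (μ : Measure Ω)
    [IsFiniteMeasure μ] {p : Set Ω → Prop} (hp : ∃ E, p E) (hm : ∀ E, p E → MeasurableSet E)
    (hu : ∀ E F, p E → p F → p (E ∪ F)) :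
    ∃ F : ℕ → Set Ω, (∀ n, p (F n)) ∧ ∀ E, p E → μ (E \ ⋃ n, F n) = 0 := by
  obtain ⟨u, -, hu_lim, hu_mem⟩ := exists_seq_tendsto_sSup (S := μ '' {E | p E})
    (Set.Nonempty.image μ hp) (OrderTop.bddAbove _)
  choose F hF hFu using hu_mem
  refine ⟨F, hF, fun E hE => ?_⟩
  set S := sSup (μ '' {E | p E})
  have hS : S ≠ ⊤ := ne_top_of_le_ne_top (measure_ne_top μ Set.univ) <|
    sSup_le <| by rintro _ ⟨E, -, rfl⟩; exact measure_mono (Set.subset_univ E)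
  have h (n : ℕ) : μ (E \ ⋃ n, F n) ≤ S - u n := by
    rw [← hFu n]
    refine ENNReal.le_sub_of_add_le_right (measure_ne_top _ _) ?_
    rw [← measure_union (Set.disjoint_sdiff_left.mono_right (Set.subset_iUnion F n))
      (hm _ (hF n))]
    refine (measure_mono (Set.union_subset_union_left _ Set.sdiff_subset)).trans ?_
    exact le_sSup ⟨_, hu _ _ hE (hF n), rfl⟩
  have hlim : Filter.Tendsto (fun n => S - u n) Filter.atTop (nhds (S - S)) :=
    ENNReal.Tendsto.sub tendsto_const_nhds hu_lim (.inl hS)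
  rw [tsub_self] at hlim
  exact le_antisymm (ge_of_tendsto' hlim h) zero_le

section L0

variable {Ω : Type*} [MeasurableSpace Ω] {μ : Measure Ω}

noncomputable instance : Algebra ℂ (Ω →ₘ[μ] ℂ) :=
  Algebra.ofModule
    (fun c f g => AEEqFun.ext <| by
      filter_upwards [AEEqFun.coeFn_mul (c • f) g, AEEqFun.coeFn_smul c (f * g),
        AEEqFun.coeFn_mul f g, AEEqFun.coeFn_smul c f] with ω h1 h2 h3 h4
      simp [h1, h2, h3, h4, mul_assoc])
    (fun c f g => AEEqFun.ext <| by
      filter_upwards [AEEqFun.coeFn_mul f (c • g), AEEqFun.coeFn_smul c (f * g),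
        AEEqFun.coeFn_mul f g, AEEqFun.coeFn_smul c g] with ω h1 h2 h3 h4
      simp [h1, h2, h3, h4, mul_left_comm])

theorem coeFn_indAE {E : Set Ω} (hE : MeasurableSet E) :
    indAE μ E hE =ᵐ[μ] E.indicator fun _ => (1 : ℂ) :=
  AEEqFun.coeFn_mk _ _

theorem isIdempotentElem_indAE {E : Set Ω} (hE : MeasurableSet E) :
    IsIdempotentElem (indAE μ E hE) := AEEqFun.ext <| by
  filter_upwards [AEEqFun.coeFn_mul (indAE μ E hE) (indAE μ E hE), coeFn_indAE hE] with ω h1 h2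
  by_cases h : ω ∈ E <;> simp [h1, h2, h]

theorem indAE_eq_zero_iff {E : Set Ω} (hE : MeasurableSet E) : indAE μ E hE = 0 ↔ μ E = 0 := by
  rw [measure_eq_zero_iff_ae_notMem, AEEqFun.ext_iff]
  refine Filter.eventually_congr ?_
  filter_upwards [coeFn_indAE (μ := μ) hE, AEEqFun.coeFn_zero (μ := μ) (β := ℂ)] with ω h1 h2
  by_cases h : ω ∈ E <;> simp [h1, h2, h]

theorem measurableSet_support_coeFn (f : Ω →ₘ[μ] ℂ) : MeasurableSet (Function.support f) :=
  measurableSet_support f.measurable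

/-- The pointwise inverse of an element of `L⁰`, equal to zero where the element vanishes. -/
noncomputable def invAE (f : Ω →ₘ[μ] ℂ) : Ω →ₘ[μ] ℂ :=
  AEEqFun.compMeasurable Inv.inv measurable_inv f

theorem coeFn_invAE (f : Ω →ₘ[μ] ℂ) : invAE f =ᵐ[μ] fun ω => (f ω)⁻¹ :=
  AEEqFun.coeFn_compMeasurable _ _ _

theorem mul_invAE (f : Ω →ₘ[μ] ℂ) :
    f * invAE f = indAE μ (Function.support f) (measurableSet_support_coeFn f) :=
  AEEqFun.ext <| by
    filter_upwards [AEEqFun.coeFn_mul f (invAE f), coeFn_invAE f,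
      coeFn_indAE (μ := μ) (measurableSet_support_coeFn f)] with ω h1 h2 h3
    by_cases h : f ω = 0 <;> simp [h1, h2, h3, h]

theorem indAE_support_mul (f : Ω →ₘ[μ] ℂ) :
    indAE μ (Function.support f) (measurableSet_support_coeFn f) * f = f :=
  AEEqFun.ext <| by
    filter_upwards [AEEqFun.coeFn_mul (indAE μ _ (measurableSet_support_coeFn f)) f,
      coeFn_indAE (μ := μ) (measurableSet_support_coeFn f)] with ω h1 h2
    by_cases h : f ω = 0 <;> simp [h1, h2, h]

theorem exists_mul_mul_self_eq (f : Ω →ₘ[μ] ℂ) : ∃ f', f * f' * f = f :=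
  ⟨invAE f, by rw [mul_invAE, indAE_support_mul]⟩

theorem ae_mul_eq {f g h : Ω →ₘ[μ] ℂ} (e : f * g = h) : ∀ᵐ ω ∂μ, f ω * g ω = h ω := by
  rw [← e]
  filter_upwards [AEEqFun.coeFn_mul f g] with ω hω
  exact hω.symm

/-- `L⁰` is self-injective. -/
theorem baer_L0 [IsFiniteMeasure μ] : Module.Baer (Ω →ₘ[μ] ℂ) (Ω →ₘ[μ] ℂ) := by
  intro I φ
  obtain ⟨F, hF, hFI⟩ := exists_seq_measure_diff_iUnion_eq_zero μ
    (p := fun E => ∃ hE : MeasurableSet E, indAE μ E hE ∈ I)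
    ⟨∅, .empty, by rw [(indAE_eq_zero_iff _).2 measure_empty]; exact I.zero_mem⟩
    (fun E hE => hE.1) <| by
      rintro E F ⟨hE, hEI⟩ ⟨hF, hFI⟩
      refine ⟨hE.union hF, ?_⟩
      have : indAE μ (E ∪ F) (hE.union hF) =
          indAE μ E hE + (1 - indAE μ E hE) * indAE μ F hF := AEEqFun.ext <| by
        filter_upwards [coeFn_indAE (μ := μ) (hE.union hF), coeFn_indAE (μ := μ) hE,
          coeFn_indAE (μ := μ) hF, AEEqFun.coeFn_one (μ := μ) (β := ℂ),
          AEEqFun.coeFn_sub (1 : Ω →ₘ[μ] ℂ) (indAE μ E hE),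
          AEEqFun.coeFn_mul (1 - indAE μ E hE) (indAE μ F hF),
          AEEqFun.coeFn_add (indAE μ E hE) ((1 - indAE μ E hE) * indAE μ F hF)]
          with ω h1 h2 h3 h4 h5 h6 h7
        rw [h7, Pi.add_apply, h6, Pi.mul_apply, h5, Pi.sub_apply, h1, h2, h3, h4]
        by_cases hωE : ω ∈ E <;> by_cases hωF : ω ∈ F <;> simp [hωE, hωF]
      rw [this]
      exact I.add_mem hEI (I.mul_mem_left _ hFI)
  choose hFm hF using hF
  obtain ⟨a, ha, haF⟩ := exists_measurable_piecewise (disjointed F)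
    (fun n => .disjointed hFm n) (fun n => (φ ⟨_, hF n⟩ : Ω →ₘ[μ] ℂ))
    (fun n => AEEqFun.measurable _)
    (fun i j hij => by
      change Set.EqOn _ _ _
      rw [(disjoint_disjointed F hij).inter_eq]
      exact Set.eqOn_empty _ _)
  let a' : Ω →ₘ[μ] ℂ := AEEqFun.mk a ha.aestronglyMeasurable
  refine ⟨LinearMap.toSpanSingleton _ _ a', fun f hf => AEEqFun.ext ?_⟩
  have hsupp : μ (Function.support f \ ⋃ n, F n) = 0 :=
    hFI _ ⟨measurableSet_support_coeFn f, by rw [← mul_invAE]; exact I.mul_mem_right _ hf⟩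
  have h0 : indAE μ _ (measurableSet_support_coeFn f) * φ ⟨f, hf⟩ = φ ⟨f, hf⟩ := by
    rw [← smul_eq_mul, ← map_smul]
    congr 1
    exact Subtype.ext (indAE_support_mul f)
  have hn (n : ℕ) : indAE μ (F n) (hFm n) * φ ⟨f, hf⟩ = f * φ ⟨_, hF n⟩ := by
    rw [← smul_eq_mul, ← smul_eq_mul, ← map_smul, ← map_smul]
    congr 1
    exact Subtype.ext (mul_comm _ _)
  filter_upwards [ae_all_iff.2 fun n => ae_mul_eq (hn n),
    ae_all_iff.2 fun n => AEEqFun.coeFn_mul f (φ ⟨_, hF n⟩), ae_mul_eq h0,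
    measure_eq_zero_iff_ae_notMem.1 hsupp, AEEqFun.coeFn_mul f a',
    AEEqFun.coeFn_mk a ha.aestronglyMeasurable, ae_all_iff.2 fun n => coeFn_indAE (μ := μ) (hFm n),
    coeFn_indAE (μ := μ) (measurableSet_support_coeFn f)] with ω h1 h2 h3 h4 h5 h6 h7 h8
  change (f * a') ω = _
  rw [h5, Pi.mul_apply, h6]
  by_cases hω : f ω = 0
  · rw [← h3, h8]
    simp [hω]
  · have hω' : ω ∈ ⋃ n, F n := by
      by_contra h
      exact h4 ⟨hω, h⟩
    rw [← iUnion_disjointed] at hω'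
    obtain ⟨n, hωn⟩ := Set.mem_iUnion.1 hω'
    have h := h1 n
    rw [h7, h2, Set.indicator_of_mem (disjointed_subset F n hωn), one_mul] at h
    rw [h, haF n hωn, Pi.mul_apply]

theorem dvd_indAE {f : Ω →ₘ[μ] ℂ} {E : Set Ω} (hE : MeasurableSet E)
    (h : ∀ᵐ ω ∂μ, ω ∈ E → f ω ≠ 0) : f ∣ indAE μ E hE := by
  refine ⟨invAE f * indAE μ E hE, AEEqFun.ext ?_⟩
  filter_upwards [AEEqFun.coeFn_mul f (invAE f * indAE μ E hE),
    AEEqFun.coeFn_mul (invAE f) (indAE μ E hE), coeFn_invAE f, coeFn_indAE (μ := μ) hE, h]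
    with ω h1 h2 h3 h4 h5
  rw [h1, Pi.mul_apply, h2, Pi.mul_apply, h3, h4]
  by_cases hω : ω ∈ E
  · simp [hω, h5 hω]
  · simp [hω]

/-- The derivation of `L⁰` underlying a linear map satisfying the Leibniz rule. -/
noncomputable def IsDeriv.toDerivation {D : (Ω →ₘ[μ] ℂ) →ₗ[ℂ] (Ω →ₘ[μ] ℂ)} (hD : IsDeriv D) :
    Derivation ℂ (Ω →ₘ[μ] ℂ) (Ω →ₘ[μ] ℂ) :=
  Derivation.mk' D fun f g => by
    rw [hD f g, smul_eq_mul, smul_eq_mul, mul_comm (D f), add_comm]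

theorem Derivation.isDeriv (D : Derivation ℂ (Ω →ₘ[μ] ℂ) (Ω →ₘ[μ] ℂ)) :
    IsDeriv (D : (Ω →ₘ[μ] ℂ) →ₗ[ℂ] (Ω →ₘ[μ] ℂ)) := fun f g => by
  change D (f * g) = D f * g + f * D g
  rw [D.leibniz, smul_eq_mul, smul_eq_mul, mul_comm g, add_comm]

theorem exists_derivation_ne_zero_of_no_atoms [IsFiniteMeasure μ] {A : Set Ω}
    (hA : MeasurableSet A) (hA0 : 0 < μ A) (hat : ∀ B ⊆ A, ¬ IsMeasAtom μ B) :
    ∃ D : Derivation ℂ (Ω →ₘ[μ] ℂ) (Ω →ₘ[μ] ℂ), D ≠ 0 := by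
  obtain ⟨g, hg, hgA⟩ := exists_measurable_fiber_null μ hA hat
  let G : Ω →ₘ[μ] ℂ := AEEqFun.mk g hg.aestronglyMeasurable
  obtain ⟨D, hD⟩ := (baer_L0 (μ := μ)).exists_derivation (k := ℂ) G (indAE μ A hA) <| by
    intro r hr
    by_contra h0
    set f := r * indAE μ A hA with hf
    have hfE := indAE_support_mul f
    refine KaehlerDifferential.smul_D_ne_zero (k := ℂ) (g := G)
      (isIdempotentElem_indAE (measurableSet_support_coeFn f)) (fun h => h0 ?_) (fun c => ?_) ?_
    · rw [← hfE, h, zero_mul]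
    · refine dvd_indAE _ ?_
      filter_upwards [AEEqFun.coeFn_sub G (algebraMap ℂ (Ω →ₘ[μ] ℂ) c),
        AEEqFun.coeFn_mk g hg.aestronglyMeasurable,
        AEEqFun.coeFn_smul c (1 : Ω →ₘ[μ] ℂ), AEEqFun.coeFn_one (μ := μ) (β := ℂ),
        AEEqFun.coeFn_mul r (indAE μ A hA), coeFn_indAE (μ := μ) hA,
        measure_eq_zero_iff_ae_notMem.1 (hgA c)] with ω h1 h2 h3 h4 h5 h6 h7 hω
      have hωA : ω ∈ A := by
        by_contra hωA
        exact hω (by rw [hf, h5, Pi.mul_apply, h6, Set.indicator_of_notMem hωA, mul_zero])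
      rw [Algebra.algebraMap_eq_smul_one] at h1 ⊢
      rw [h1, Pi.sub_apply, h3, Pi.smul_apply, h4, h2, Pi.one_apply, smul_eq_mul, mul_one,
        sub_ne_zero]
      exact fun h => h7 ⟨hωA, h⟩
    · rw [← mul_invAE, hf, mul_comm _ (invAE _), mul_comm r, ← mul_assoc, mul_smul, hr, smul_zero]
  refine ⟨D, fun h => hA0.ne' ((indAE_eq_zero_iff hA).1 ?_)⟩
  rw [← hD, h, Derivation.coe_zero, Pi.zero_apply]

theorem IsMeasAtom.exists_ae_eq_const {B : Set Ω} [IsFiniteMeasure μ] (hB : IsMeasAtom μ B)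
    {f : Ω → ℂ} (hf : Measurable f) : ∃ c, ∀ᵐ ω ∂μ, ω ∈ B → f ω = c := by
  obtain ⟨c, hc⟩ := Filter.exists_eventuallyEq_const_of_forall_separating
    (l := ae (μ.restrict B)) (f := f) MeasurableSet fun U hU => by
      rw [ae_restrict_iff' hB.1, ae_restrict_iff' hB.1]
      rcases hB.2.2 (B ∩ f ⁻¹' U) Set.inter_subset_left (hB.1.inter (hf hU)) with h | h
      · right
        filter_upwards [measure_eq_zero_iff_ae_notMem.1 h] with ω h1 h2 h3
        exact h1 ⟨h2, h3⟩
      · left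
        have h4 : μ (B \ f ⁻¹' U) = 0 := by
          have h5 := measure_inter_add_sdiff (μ := μ) B (hf hU)
          rw [h] at h5
          exact (ENNReal.add_right_inj (measure_ne_top μ B)).1 (h5.trans (add_zero _).symm)
        filter_upwards [measure_eq_zero_iff_ae_notMem.1 h4] with ω h1 h2
        by_contra h3
        exact h1 ⟨h2, h3⟩
  exact ⟨c, (ae_restrict_iff' hB.1).1 hc⟩

theorem exists_set_without_atoms_of_derivation_ne_zero [IsFiniteMeasure μ]
    {D : Derivation ℂ (Ω →ₘ[μ] ℂ) (Ω →ₘ[μ] ℂ)} (hD : D ≠ 0) :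
    ∃ A : Set Ω, MeasurableSet A ∧ 0 < μ A ∧ ∀ B ⊆ A, ¬ IsMeasAtom μ B := by
  obtain ⟨f, hf⟩ : ∃ f, D f ≠ 0 := by
    by_contra! h
    exact hD (Derivation.ext h)
  refine ⟨Function.support (D f), measurableSet_support_coeFn _, pos_iff_ne_zero.2 fun h => hf ?_,
    fun B hBs hB => hB.2.1.ne' ?_⟩
  · rw [← indAE_support_mul (D f), (indAE_eq_zero_iff _).2 h, zero_mul]
  obtain ⟨c, hc⟩ := hB.exists_ae_eq_const f.measurable
  have h1 : indAE μ B hB.1 * f = c • indAE μ B hB.1 := AEEqFun.ext <| by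
    filter_upwards [hc, AEEqFun.coeFn_mul (indAE μ B hB.1) f, coeFn_indAE (μ := μ) hB.1,
      AEEqFun.coeFn_smul c (indAE μ B hB.1)] with ω h1 h2 h3 h4
    rw [h2, h4, Pi.mul_apply, Pi.smul_apply, h3]
    by_cases hω : ω ∈ B
    · simp [hω, h1 hω]
    · simp [hω]
  have h2 : indAE μ B hB.1 * D f = 0 := by
    have h3 := congrArg D h1
    rwa [D.leibniz, D.map_smul, D.map_idempotent (isIdempotentElem_indAE hB.1), smul_zero,
      smul_zero, add_zero] at h3
  rw [measure_eq_zero_iff_ae_notMem]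
  filter_upwards [ae_mul_eq h2, coeFn_indAE (μ := μ) hB.1, AEEqFun.coeFn_zero (μ := μ) (β := ℂ)]
    with ω h3 h4 h5 hω
  rw [h4, h5, Set.indicator_of_mem hω, one_mul] at h3
  exact hBs hω h3

theorem isLocalDeriv_comp_self (D : Derivation ℂ (Ω →ₘ[μ] ℂ) (Ω →ₘ[μ] ℂ)) :
    IsLocalDeriv ((D : (Ω →ₘ[μ] ℂ) →ₗ[ℂ] (Ω →ₘ[μ] ℂ)).comp
      (D : (Ω →ₘ[μ] ℂ) →ₗ[ℂ] (Ω →ₘ[μ] ℂ))) := fun f => by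
  obtain ⟨a, ha⟩ := D.exists_smul_apply_eq exists_mul_mul_self_eq f
  exact ⟨_, (a • D).isDeriv, ha⟩

end L0

/-- Corollary 3.7: for a finite measure space (Ω,Σ,μ), the
following are equivalent: (i) μ is not purely atomic (some set of positive
measure contains no atom); (ii) L⁰ admits a non-zero derivation; (iii) L⁰
admits a non-zero local derivation; (iv) L⁰ admits a local derivation which
is not a derivation. -/
theorem L0_localDerivation_atomic_tfae
    {Ω : Type*} [MeasurableSpace Ω] (μ : Measure Ω) [IsFiniteMeasure μ] :
    List.TFAE
      [∃ A : Set Ω, MeasurableSet A ∧ 0 < μ A ∧ ∀ B ⊆ A, ¬ IsMeasAtom μ B,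
       ∃ D : (Ω →ₘ[μ] ℂ) →ₗ[ℂ] (Ω →ₘ[μ] ℂ), IsDeriv D ∧ D ≠ 0,
       ∃ Δ : (Ω →ₘ[μ] ℂ) →ₗ[ℂ] (Ω →ₘ[μ] ℂ), IsLocalDeriv Δ ∧ Δ ≠ 0,
       ∃ Δ : (Ω →ₘ[μ] ℂ) →ₗ[ℂ] (Ω →ₘ[μ] ℂ), IsLocalDeriv Δ ∧ ¬ IsDeriv Δ] := by
  tfae_have 1 → 2 := by
    rintro ⟨A, hA, hA0, hat⟩
    obtain ⟨D, hD⟩ := exists_derivation_ne_zero_of_no_atoms hA hA0 hat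
    exact ⟨D, D.isDeriv, fun h => hD (Derivation.ext fun f => LinearMap.congr_fun h f)⟩
  tfae_have 2 → 1 := by
    rintro ⟨D, hD, hD0⟩
    refine exists_set_without_atoms_of_derivation_ne_zero (D := hD.toDerivation) fun h => hD0 ?_
    exact LinearMap.ext fun f => DFunLike.congr_fun h f
  tfae_have 2 → 4 := by
    rintro ⟨D, hD, hD0⟩
    refine ⟨_, isLocalDeriv_comp_self hD.toDerivation, fun h => hD0 ?_⟩
    have h0 := hD.toDerivation.eq_zero_of_leibniz_comp_self exists_mul_mul_self_eq h
    exact LinearMap.ext fun f => DFunLike.congr_fun h0 f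
  tfae_have 4 → 3 := by
    rintro ⟨Δ, hΔ, hΔ'⟩
    exact ⟨Δ, hΔ, fun h => hΔ' (by rw [h]; exact fun f g => by simp)⟩
  tfae_have 3 → 2 := by
    rintro ⟨Δ, hΔ, hΔ0⟩
    obtain ⟨f, hf⟩ : ∃ f, Δ f ≠ 0 := by
      by_contra! h
      exact hΔ0 (LinearMap.ext h)
    obtain ⟨D, hD, hDf⟩ := hΔ f
    exact ⟨D, hD, fun h => hf (by rw [hDf, h, LinearMap.zero_apply])⟩
  tfae_finish
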